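/- Algebraic Stability Theorem: For any two persistence modules V and W with barcodes B(V) and B(W) (i.e., finite multisets of intervals with V ≅ ⊕_{I∈B(V)} 𝔽(I) and W ≅ ⊕_{J∈B(W)} 𝔽(J)), one has d_int(V,W) ≥ d_bot(B(V), B(W)). -/

import Mathlib

open Classical

noncomputable section

/-- A persistence module over a field `𝔽`: a family of finite-dimensional vector
spaces indexed by `ℝ` together with transition maps satisfying the persistence laws. -/
structure PersistenceModule (𝔽 : Type) [Field 𝔽] where
  V : ℝ → Type
  [grp : ∀ t, AddCommGroup (V t)]
  [mod : ∀ t, Module 𝔽 (V t)]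
  [fin : ∀ t, FiniteDimensional 𝔽 (V t)]
  π : ∀ s t : ℝ, s ≤ t → (V s →ₗ[𝔽] V t)
  π_refl : ∀ t : ℝ, π t t le_rfl = LinearMap.id
  π_comp : ∀ (s t r : ℝ) (hst : s ≤ t) (htr : t ≤ r),
    (π t r htr).comp (π s t hst) = π s r (hst.trans htr)

attribute [instance] PersistenceModule.grp PersistenceModule.mod PersistenceModule.fin

namespace PersistenceModule

variable {𝔽 : Type} [Field 𝔽]

/-- The regularity ("finite type", semicontinuity and lower-boundedness) axioms of a
persistence module: away from a finite set, transition maps are locally isomorphisms;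
the module is semicontinuous from the left; and it vanishes for `s` sufficiently small. -/
def IsRegular (M : PersistenceModule 𝔽) : Prop :=
  (∃ S : Finset ℝ, ∀ t : ℝ, t ∉ S → ∃ U ∈ nhds t,
    ∀ s ∈ U, ∀ r ∈ U, ∀ h : s ≤ r, Function.Bijective (M.π s r h)) ∧
  (∀ t : ℝ, ∃ ε : ℝ, 0 < ε ∧ ∀ s : ℝ, t - ε < s → ∀ h : s ≤ t, Function.Bijective (M.π s t h)) ∧
  (∃ s₀ : ℝ, ∀ s : ℝ, s ≤ s₀ → ∀ x : M.V s, x = 0)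

/-- A morphism of persistence modules. -/
structure Hom (M N : PersistenceModule 𝔽) where
  A : ∀ t : ℝ, M.V t →ₗ[𝔽] N.V t
  comm : ∀ (s t : ℝ) (h : s ≤ t), (A t).comp (M.π s t h) = (N.π s t h).comp (A s)

/-- Two persistence modules are isomorphic if there are mutually inverse morphisms. -/
def Iso (M N : PersistenceModule 𝔽) : Prop :=
  ∃ (f : Hom M N) (g : Hom N M),
    (∀ (t : ℝ) (x : M.V t), g.A t (f.A t x) = x) ∧
    (∀ (t : ℝ) (y : N.V t), f.A t (g.A t y) = y)

/-- `δ`-interleaving of two persistence modules, stated pointwise (`F, G` are the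
interleaving morphisms `V → W[δ]`, `W → V[δ]`, and the two triangles express that the
compositions are the `2δ`-shift morphisms). -/
def Interleaved (M N : PersistenceModule 𝔽) (δ : ℝ) : Prop :=
  ∃ (F : ∀ t : ℝ, M.V t →ₗ[𝔽] N.V (t + δ)) (G : ∀ t : ℝ, N.V t →ₗ[𝔽] M.V (t + δ)),
    (∀ (s t : ℝ) (h : s ≤ t),
      (F t).comp (M.π s t h) = (N.π (s + δ) (t + δ) (by linarith)).comp (F s)) ∧
    (∀ (s t : ℝ) (h : s ≤ t),
      (G t).comp (N.π s t h) = (M.π (s + δ) (t + δ) (by linarith)).comp (G s)) ∧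
    (∀ (t : ℝ) (h : t ≤ t + δ + δ),
      (G (t + δ)).comp (F t) = M.π t (t + δ + δ) h) ∧
    (∀ (t : ℝ) (h : t ≤ t + δ + δ),
      (F (t + δ)).comp (G t) = N.π t (t + δ + δ) h)

/-- Interleaving distance, with value in `EReal` (`+∞` if no interleaving exists). -/
def dInt (M N : PersistenceModule 𝔽) : EReal :=
  sInf {x : EReal | ∃ δ : ℝ, 0 < δ ∧ x = (δ : EReal) ∧ Interleaved M N δ}

/-- The persistence submodule of `(-1)`-eigenspaces of an endomorphism `A` of `M`. -/
def negEigen (M : PersistenceModule 𝔽) (A : Hom M M) : PersistenceModule 𝔽 where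
  V t := ↥(LinearMap.ker (A.A t + (LinearMap.id : M.V t →ₗ[𝔽] M.V t)))
  π s t h := LinearMap.restrict (M.π s t h) (by
    intro x hx
    have hc := congrArg (fun f : M.V s →ₗ[𝔽] M.V t => f x) (A.comm s t h)
    simp only [LinearMap.comp_apply] at hc
    simp only [LinearMap.mem_ker, LinearMap.add_apply, LinearMap.id_apply] at hx ⊢
    rw [hc, ← map_add (M.π s t h), hx, map_zero])
  π_refl t := by
    apply LinearMap.ext
    intro x
    apply Subtype.ext
    have := congrArg (fun f : M.V t →ₗ[𝔽] M.V t => f (x : M.V t)) (M.π_refl t)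
    simpa [LinearMap.restrict_apply] using this
  π_comp s t r hst htr := by
    apply LinearMap.ext
    intro x
    apply Subtype.ext
    have := congrArg (fun f : M.V s →ₗ[𝔽] M.V r => f (x : M.V s)) (M.π_comp s t r hst htr)
    simpa [LinearMap.restrict_apply] using this

/-- `(δ, ℤ₂)`-equivariant interleaving of two persistence modules with involutions
`AM` and `AN`. -/
def Z2Interleaved (M N : PersistenceModule 𝔽) (AM : Hom M M) (AN : Hom N N) (δ : ℝ) : Prop :=
  ∃ (F : ∀ t : ℝ, M.V t →ₗ[𝔽] N.V (t + δ)) (G : ∀ t : ℝ, N.V t →ₗ[𝔽] M.V (t + δ)),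
    (∀ (s t : ℝ) (h : s ≤ t),
      (F t).comp (M.π s t h) = (N.π (s + δ) (t + δ) (by linarith)).comp (F s)) ∧
    (∀ (s t : ℝ) (h : s ≤ t),
      (G t).comp (N.π s t h) = (M.π (s + δ) (t + δ) (by linarith)).comp (G s)) ∧
    (∀ (t : ℝ) (h : t ≤ t + δ + δ),
      (G (t + δ)).comp (F t) = M.π t (t + δ + δ) h) ∧
    (∀ (t : ℝ) (h : t ≤ t + δ + δ),
      (F (t + δ)).comp (G t) = N.π t (t + δ + δ) h) ∧
    (∀ t : ℝ, (F t).comp (AM.A t) = (AN.A (t + δ)).comp (F t)) ∧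
    (∀ t : ℝ, (G t).comp (AN.A t) = (AM.A (t + δ)).comp (G t))

/-- The `ℤ₂`-interleaving distance, with value in `EReal`. -/
def dZ2Int (M N : PersistenceModule 𝔽) (AM : Hom M M) (AN : Hom N N) : EReal :=
  sInf {x : EReal | ∃ δ : ℝ, 0 < δ ∧ x = (δ : EReal) ∧ Z2Interleaved M N AM AN δ}

end PersistenceModule

/-- A bar `(a, b]` is recorded as the pair of its left endpoint `a ∈ ℝ`
and its right endpoint `b ∈ ℝ ∪ {±∞}`. -/
abbrev Bar := ℝ × EReal

/-- A bar is valid if `a < b` (so it encodes a nonempty interval `(a,b]`, `b ≤ +∞`). -/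
def Bar.valid (I : Bar) : Prop := (I.1 : EReal) < I.2

/-- Membership `t ∈ (a, b]`. -/
def Bar.has (I : Bar) (t : ℝ) : Prop := I.1 < t ∧ (t : EReal) ≤ I.2

/-- The fiber at `t` of the interval module of `I`, as a submodule of `𝔽`. -/
def barSub (𝔽 : Type) [Field 𝔽] (I : Bar) (t : ℝ) : Submodule 𝔽 𝔽 :=
  if Bar.has I t then ⊤ else ⊥

lemma barSub_coe_zero {𝔽 : Type} [Field 𝔽] {I : Bar} {t : ℝ}
    (hm : ¬ Bar.has I t) (x : barSub 𝔽 I t) : (x : 𝔽) = 0 := by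
  have hx := x.2
  simp only [barSub, if_neg hm, Submodule.mem_bot] at hx
  exact hx

/-- The transition maps of an interval module. -/
def barMap (𝔽 : Type) [Field 𝔽] (I : Bar) (s t : ℝ) :
    barSub 𝔽 I s →ₗ[𝔽] barSub 𝔽 I t where
  toFun x := ⟨if Bar.has I t then (x : 𝔽) else 0, by
    split_ifs with hm
    · simp [barSub, hm]
    · exact (barSub 𝔽 I t).zero_mem⟩
  map_add' x y := by
    apply Subtype.ext
    by_cases hm : Bar.has I t <;> simp [hm]
  map_smul' c x := by
    apply Subtype.ext
    by_cases hm : Bar.has I t <;> simp [hm]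

lemma barMap_coe (𝔽 : Type) [Field 𝔽] (I : Bar) (s t : ℝ) (x : barSub 𝔽 I s) :
    (barMap 𝔽 I s t x : 𝔽) = if Bar.has I t then (x : 𝔽) else 0 := rfl

lemma barMap_refl {𝔽 : Type} [Field 𝔽] {I : Bar} {t : ℝ} (x : barSub 𝔽 I t) :
    barMap 𝔽 I t t x = x := by
  apply Subtype.ext
  rw [barMap_coe]
  split_ifs with hm
  · rfl
  · exact (barSub_coe_zero hm x).symm

lemma barMap_comp {𝔽 : Type} [Field 𝔽] {I : Bar} {s t r : ℝ} (hst : s ≤ t) (htr : t ≤ r)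
    (x : barSub 𝔽 I s) :
    barMap 𝔽 I t r (barMap 𝔽 I s t x) = barMap 𝔽 I s r x := by
  apply Subtype.ext
  rw [barMap_coe, barMap_coe, barMap_coe]
  by_cases hr : Bar.has I r
  · by_cases ht : Bar.has I t
    · simp [hr, ht]
    · have ht2 : (t : EReal) ≤ I.2 := le_trans (by exact_mod_cast htr) hr.2
      have ht1 : ¬ I.1 < t := fun h => ht ⟨h, ht2⟩
      have hs1 : ¬ Bar.has I s := fun hs => ht1 (lt_of_lt_of_le hs.1 hst)
      rw [barSub_coe_zero hs1 x]
      simp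
  · simp [hr]

/-- The interval persistence module `𝔽(a,b]`. -/
def intervalModule (𝔽 : Type) [Field 𝔽] (I : Bar) : PersistenceModule 𝔽 where
  V t := ↥(barSub 𝔽 I t)
  π s t _ := barMap 𝔽 I s t
  π_refl t := LinearMap.ext fun x => barMap_refl x
  π_comp _ _ _ hst htr := LinearMap.ext fun x => barMap_comp hst htr x

/-- The direct sum `⊕_{I ∈ B} 𝔽(I)` of the interval modules of the bars of a
barcode `B` (a finite multiset of bars), taken pointwise in `t`. -/
def barcodeModule (𝔽 : Type) [Field 𝔽] (B : Multiset Bar) : PersistenceModule 𝔽 where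
  V t := ∀ i : Fin B.toList.length, ↥(barSub 𝔽 (B.toList.get i) t)
  π s t _ := LinearMap.pi fun i => (barMap 𝔽 (B.toList.get i) s t).comp (LinearMap.proj i)
  π_refl t := by
    apply LinearMap.ext
    intro x
    funext i
    simpa using barMap_refl (x i)
  π_comp s t r hst htr := by
    apply LinearMap.ext
    intro x
    funext i
    simpa using barMap_comp hst htr (x i)

/-- `Multiset.filter` with classical decidability. -/
def cfilter {α : Type} (p : α → Prop) (s : Multiset α) : Multiset α :=
  @Multiset.filter α p (Classical.decPred p) s

/-- A bar of length `> 2δ`. -/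
def BarLong (δ : ℝ) (I : Bar) : Prop := ((2 * δ : ℝ) : EReal) < I.2 - (I.1 : EReal)

/-- Two bars matched within error `δ`: left endpoints within `δ` of each other, and
either both right endpoints equal `+∞`, or both are finite and within `δ`. -/
def BarClose (δ : ℝ) (I J : Bar) : Prop :=
  |I.1 - J.1| ≤ δ ∧
    ((I.2 = ⊤ ∧ J.2 = ⊤) ∨ (I.2 ≠ ⊤ ∧ J.2 ≠ ⊤ ∧ |EReal.toReal I.2 - EReal.toReal J.2| ≤ δ))

/-- A `δ`-matching between barcodes `B` and `C`, recorded as a multiset `m` of matched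
pairs: it induces a partial bijection between a sub-multiset of `B` and a sub-multiset
of `C` which matches every bar of length `> 2δ` on both sides, and matched bars are
`δ`-close. -/
def IsMatching (δ : ℝ) (B C : Multiset Bar) (m : Multiset (Bar × Bar)) : Prop :=
  m.map Prod.fst ≤ B ∧ m.map Prod.snd ≤ C ∧
  cfilter (BarLong δ) B ≤ m.map Prod.fst ∧
  cfilter (BarLong δ) C ≤ m.map Prod.snd ∧
  ∀ p ∈ m, BarClose δ p.1 p.2

/-- The bottleneck distance between two barcodes, with value in `EReal`. -/
def dBot (B C : Multiset Bar) : EReal :=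
  sInf {x : EReal | ∃ δ : ℝ, 0 < δ ∧ x = (δ : EReal) ∧ ∃ m, IsMatching δ B C m}

/-- `m(B, (a,b])`: the number of bars of `B` (with multiplicity) containing `(a,b]`. -/
def multB (B : Multiset Bar) (a b : ℝ) : ℕ :=
  (cfilter (fun I : Bar => I.1 ≤ a ∧ (b : EReal) ≤ I.2) B).card

/-- The multiplicity function `μ_k` of a barcode, with value in `EReal`
(it equals `0` if no suitable `c` exists). -/
def muk (k : ℕ) (B : Multiset Bar) : EReal :=
  sSup (insert (0 : EReal)
    {x : EReal | ∃ c : ℝ, 0 < c ∧ x = (c : EReal) ∧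
      ∃ a b : ℝ, 4 * c < b - a ∧ multB B a b = k ∧ multB B (a + 2 * c) (b - 2 * c) = k})

/-- `μ_odd`: the supremum of `μ_k` over odd `k`. -/
def muOdd (B : Multiset Bar) : EReal :=
  sSup {x : EReal | ∃ k : ℕ, Odd k ∧ x = muk k B}

/-- `β_k`: the length of the `k`-th longest finite bar of a barcode (`0` if there are
fewer than `k` finite bars). -/
def betak (k : ℕ) (B : Multiset Bar) : ℝ :=
  ((((cfilter (fun I : Bar => I.2 ≠ ⊤) B).map
      (fun I : Bar => EReal.toReal I.2 - I.1)).sort (· ≤ ·)).reverse).getD (k - 1) 0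

end

/-- The coefficients `f i j t` of a morphism of degree `δ` between two direct sums of interval
modules, with bars `(a i, b i]` in the source and `(c j, d j]` in the target. -/
structure ShiftCoeff {𝔽 ι κ : Type} [Field 𝔽] (δ : ℝ) (a : ι → ℝ) (b : ι → EReal)
    (c : κ → ℝ) (d : κ → EReal) (f : ι → κ → ℝ → 𝔽) : Prop where
  support : ∀ i j t, f i j t ≠ 0 →
    a i < t ∧ (t : EReal) ≤ b i ∧ c j < t + δ ∧ ((t + δ : ℝ) : EReal) ≤ d j
  shift : ∀ i j s t, s ≤ t → a i < s → ((t + δ : ℝ) : EReal) ≤ d j → f i j t = f i j s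

/-- The coefficients `f`, `g` of two degree `δ` morphisms compose to the shift by `2δ`. -/
def ComposeToShift {𝔽 ι κ : Type} [Field 𝔽] [Fintype κ] (δ : ℝ) (a : ι → ℝ) (b : ι → EReal)
    (f : ι → κ → ℝ → 𝔽) (g : κ → ι → ℝ → 𝔽) : Prop :=
  ∀ i i' t, a i < t → (t : EReal) ≤ b i → a i' < t + δ + δ →
    ((t + δ + δ : ℝ) : EReal) ≤ b i' →
    ∑ j, f i j t * g j i' (t + δ) = if i = i' then 1 else 0

section Matching

variable {𝔽 ι κ : Type} [Field 𝔽] {δ : ℝ}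

/-- Over bars with real endpoints, the coefficients of a degree `δ` morphism are given by a
constant matrix. -/
lemma ShiftCoeff.exists_const {a b : ι → ℝ} {c d : κ → ℝ} {f : ι → κ → ℝ → 𝔽}
    (h : ShiftCoeff δ a (fun i => (b i : EReal)) c (fun j => (d j : EReal)) f) :
    ∃ φ : ι → κ → 𝔽, ∀ i j, (φ i j ≠ 0 → c j ≤ a i + δ ∧ d j ≤ b i + δ) ∧
      ∀ t, a i < t → t + δ ≤ d j → f i j t = φ i j := by
  have hs := h.support
  have hf := h.shift
  simp only [EReal.coe_le_coe_iff] at hs hf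
  have key : ∀ i j, ∃ x : 𝔽, (x ≠ 0 → c j ≤ a i + δ ∧ d j ≤ b i + δ) ∧
      ∀ t, a i < t → t + δ ≤ d j → f i j t = x := by
    intro i j
    by_cases hex : ∃ t₀, f i j t₀ ≠ 0
    · obtain ⟨t₀, h₀⟩ := hex
      obtain ⟨h1, h2, h3, h4⟩ := hs i j t₀ h₀
      refine ⟨f i j t₀, fun _ => ⟨?_, ?_⟩, fun t ht ht' => ?_⟩
      · by_contra! hlt
        have e := hf i j (c j - δ) t₀ (by linarith) (by linarith) h4
        have := (hs i j (c j - δ) (e ▸ h₀)).2.2.1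
        linarith
      · by_contra! hlt
        have e := hf i j t₀ (d j - δ) (by linarith) h1 (by linarith)
        have := (hs i j (d j - δ) (e.symm ▸ h₀)).2.1
        linarith
      · rcases le_total t t₀ with hle | hle
        · exact (hf i j t t₀ hle ht h4).symm
        · exact hf i j t₀ t hle h1 ht'
    · push Not at hex
      exact ⟨0, fun h => absurd rfl h, fun t _ _ => hex t⟩
  choose φ hφ using key
  exact ⟨φ, hφ⟩

lemma ShiftCoeff.eq_zero_of_const {a b : ι → ℝ} {c d : κ → ℝ} {f : ι → κ → ℝ → 𝔽}
    (h : ShiftCoeff δ a (fun i => (b i : EReal)) c (fun j => (d j : EReal)) f) {φ : 𝔽} {i : ι}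
    {j : κ} (hφ : ∀ t, a i < t → t + δ ≤ d j → f i j t = φ) (h0 : φ = 0) (t : ℝ) :
    f i j t = 0 := by
  by_contra hne
  obtain ⟨h1, -, -, h4⟩ := h.support i j t hne
  exact hne ((hφ t h1 (by exact_mod_cast h4)).trans h0)

/-- Two composable nonzero components between bars, taken in nondecreasing order of their
midpoints, pass through a bar which is close to the source or the target. -/
lemma close_or_close {a b c d a' b' : ℝ} (h1 : c ≤ a + δ) (h2 : d ≤ b + δ)
    (h3 : a' ≤ c + δ) (h4 : b' ≤ d + δ) (hle : a + b ≤ a' + b') :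
    (|a - c| ≤ δ ∧ |b - d| ≤ δ) ∨ (|a' - c| ≤ δ ∧ |b' - d| ≤ δ) := by
  by_cases hca : a - δ ≤ c <;> by_cases hdb : b - δ ≤ d
  · exact Or.inl ⟨abs_le.2 ⟨by linarith, by linarith⟩, abs_le.2 ⟨by linarith, by linarith⟩⟩
  all_goals
    refine Or.inr ⟨abs_le.2 ⟨?_, by linarith⟩, abs_le.2 ⟨?_, by linarith⟩⟩ <;>
    by_contra! hc <;> linarith

/-- Hall's condition, for bars with real endpoints. -/
lemma card_le_card_of_close [Fintype κ] {a b : ι → ℝ} {c d : κ → ℝ} {f : ι → κ → ℝ → 𝔽}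
    {g : κ → ι → ℝ → 𝔽}
    (hf : ShiftCoeff δ a (fun i => (b i : EReal)) c (fun j => (d j : EReal)) f)
    (hg : ShiftCoeff δ c (fun j => (d j : EReal)) a (fun i => (b i : EReal)) g)
    (hfg : ComposeToShift δ a (fun i => (b i : EReal)) f g) (hδ : 0 < δ)
    (A : Finset ι) (D : Finset κ) (hA : ∀ i ∈ A, 2 * δ < b i - a i)
    (hD : ∀ i ∈ A, ∀ j, |a i - c j| ≤ δ → |b i - d j| ≤ δ → j ∈ D) : A.card ≤ D.card := by
  obtain ⟨φ, hφ⟩ := hf.exists_const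
  obtain ⟨ψ, hψ⟩ := hg.exists_const
  have hterm : ∀ i i' t, a i < t → t ≤ b i → a i' < t + δ + δ → t + δ + δ ≤ b i' → ∀ j,
      φ i j * ψ j i' = f i j t * g j i' (t + δ) := by
    intro i i' t h1 h2 h3 h4 j
    by_cases hp : φ i j = 0
    · rw [hp, hf.eq_zero_of_const (hφ i j).2 hp, zero_mul, zero_mul]
    by_cases hq : ψ j i' = 0
    · rw [hq, hg.eq_zero_of_const (hψ j i').2 hq, mul_zero, mul_zero]
    have h5 := (hφ i j).1 hp
    have h6 := (hψ j i').1 hq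
    rw [(hφ i j).2 t h1 (by linarith), (hψ j i').2 (t + δ) (by linarith) h4]
  have hfull : ∀ i ∈ A, ∀ i' ∈ A, a i + b i ≤ a i' + b i' →
      ∑ j, φ i j * ψ j i' = if i = i' then 1 else 0 := by
    intro i hi i' hi' hle
    have hl := hA i hi
    have hl' := hA i' hi'
    have hcomp : ∀ t, a i < t → t ≤ b i → a i' < t + δ + δ → t + δ + δ ≤ b i' →
        ∑ j, φ i j * ψ j i' = if i = i' then 1 else 0 := by
      intro t h1 h2 h3 h4
      rw [Finset.sum_congr rfl fun j _ => hterm i i' t h1 h2 h3 h4 j]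
      exact hfg i i' t h1 (EReal.coe_le_coe_iff.2 h2) h3 (EReal.coe_le_coe_iff.2 h4)
    by_cases hii : i = i'
    · subst hii
      exact hcomp (b i - 2 * δ) (by linarith) (by linarith) (by linarith) (by linarith)
    by_cases hex : ∃ j, φ i j * ψ j i' ≠ 0
    · obtain ⟨j, hj⟩ := hex
      have h5 := (hφ i j).1 (left_ne_zero_of_mul hj)
      have h6 := (hψ j i').1 (right_ne_zero_of_mul hj)
      refine hcomp (b i' - 2 * δ) ?_ (by linarith) (by linarith) (by linarith)
      by_contra! hc
      linarith
    · push Not at hex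
      simp [hex, hii]
  have hsum : ∀ i ∈ A, ∀ i' ∈ A, a i + b i ≤ a i' + b i' →
      ∑ j ∈ D, φ i j * ψ j i' = if i = i' then 1 else 0 := by
    intro i hi i' hi' hle
    rw [← hfull i hi i' hi' hle]
    refine Finset.sum_subset (Finset.subset_univ D) fun j _ hj => ?_
    by_contra hne
    have h5 := (hφ i j).1 (left_ne_zero_of_mul hne)
    have h6 := (hψ j i').1 (right_ne_zero_of_mul hne)
    rcases close_or_close h5.1 h5.2 h6.1 h6.2 hle with h | h
    · exact hj (hD i hi j h.1 h.2)
    · exact hj (hD i' hi' j h.1 h.2)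
  let L : (A → 𝔽) →ₗ[𝔽] (D → 𝔽) := (Matrix.of fun (i : A) (j : D) => φ i j).vecMulLinear
  have hL : Function.Injective L := by
    rw [← LinearMap.ker_eq_bot, LinearMap.ker_eq_bot']
    intro x hx
    by_contra hne
    have hS : (Finset.univ.filter fun i : A => x i ≠ 0).Nonempty := by
      obtain ⟨i, hi⟩ := Function.ne_iff.1 hne
      exact ⟨i, by simpa using hi⟩
    obtain ⟨m, hm, hmax⟩ := Finset.exists_max_image _ (fun i : A => a i + b i) hS
    have hcol : ∀ j : D, ∑ i : A, x i * φ i j = 0 := fun j => congrFun hx j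
    have hm0 : x m ≠ 0 := by simpa using hm
    apply hm0
    calc x m = ∑ i : A, x i * ∑ j : D, φ i j * ψ j m := by
          rw [Finset.sum_eq_single m]
          · rw [Finset.sum_coe_sort D fun j => φ m j * ψ j m, hsum m m.2 m m.2 le_rfl]
            simp
          · intro i _ him
            by_cases hi : x i = 0
            · rw [hi, zero_mul]
            · rw [Finset.sum_coe_sort D fun j => φ i j * ψ j m,
                hsum i i.2 m m.2 (hmax i (by simpa using hi)),
                if_neg fun h => him (Subtype.ext h), mul_zero]
          · simp
      _ = ∑ j : D, (∑ i : A, x i * φ i j) * ψ j m := by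
          simp_rw [Finset.mul_sum, Finset.sum_mul]
          rw [Finset.sum_comm]
          simp_rw [mul_assoc]
      _ = 0 := Finset.sum_eq_zero fun j _ => by rw [hcol j, zero_mul]
  simpa using LinearMap.finrank_le_finrank_of_injective hL

/-- An injection from the long bars of one side into close bars of the other side, for bars with
real endpoints. -/
lemma exists_injective_close_real [Fintype κ] {a b : ι → ℝ} {c d : κ → ℝ} {f : ι → κ → ℝ → 𝔽}
    {g : κ → ι → ℝ → 𝔽}
    (hf : ShiftCoeff δ a (fun i => (b i : EReal)) c (fun j => (d j : EReal)) f)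
    (hg : ShiftCoeff δ c (fun j => (d j : EReal)) a (fun i => (b i : EReal)) g)
    (hfg : ComposeToShift δ a (fun i => (b i : EReal)) f g) (hδ : 0 < δ) :
    ∃ p : {i // 2 * δ < b i - a i} → κ, Function.Injective p ∧
      ∀ i : {i // 2 * δ < b i - a i}, |a i - c (p i)| ≤ δ ∧ |b i - d (p i)| ≤ δ := by
  let t : {i // 2 * δ < b i - a i} → Finset κ := fun i =>
    Finset.univ.filter fun j => |a i - c j| ≤ δ ∧ |b i - d j| ≤ δ
  obtain ⟨p, hp, hpt⟩ := (Finset.all_card_le_biUnion_card_iff_exists_injective t).1 (by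
    intro s
    rw [← Finset.card_map (Function.Embedding.subtype _)]
    refine card_le_card_of_close hf hg hfg hδ _ _ (fun i hi => ?_) fun i hi j h1 h2 => ?_
    · obtain ⟨i, -, rfl⟩ := Finset.mem_map.1 hi
      exact i.2
    · obtain ⟨i, his, rfl⟩ := Finset.mem_map.1 hi
      exact Finset.mem_biUnion.2 ⟨i, his, by simpa [t] using ⟨h1, h2⟩⟩)
  exact ⟨p, hp, fun i => by simpa [t] using hpt i⟩

/-- The right endpoint of a bar, with `+∞` replaced by `T`. -/
noncomputable def truncEnd (T : ℝ) (x : EReal) : ℝ := if x = ⊤ then T else x.toReal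

lemma le_truncEnd_iff {T t : ℝ} {x : EReal} (hx : x ≠ ⊥) (ht : t ≤ T) :
    t ≤ truncEnd T x ↔ (t : EReal) ≤ x := by
  induction x with
  | bot => exact absurd rfl hx
  | top => simpa [truncEnd] using ht
  | coe y => simp [truncEnd]

lemma truncEnd_le {T : ℝ} {x : EReal} (hx : x ≠ ⊤ → x.toReal ≤ T) : truncEnd T x ≤ T := by
  unfold truncEnd
  split_ifs with h
  · exact le_rfl
  · exact hx h

lemma ShiftCoeff.trunc {a : ι → ℝ} {b : ι → EReal} {c : κ → ℝ} {d : κ → EReal}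
    {f : ι → κ → ℝ → 𝔽} (h : ShiftCoeff δ a b c d f) (hδ : 0 < δ) {T : ℝ}
    (hb : ∀ i, b i ≠ ⊥) (hd : ∀ j, d j ≠ ⊥) (hdT : ∀ j, d j ≠ ⊤ → (d j).toReal ≤ T) :
    ShiftCoeff δ a (fun i => (truncEnd T (b i) : EReal)) c (fun j => (truncEnd T (d j) : EReal))
      (fun i j t => if t + δ ≤ T then f i j t else 0) where
  support i j t hne := by
    obtain ⟨hT, hne⟩ := ite_ne_right_iff.1 hne
    obtain ⟨h1, h2, h3, h4⟩ := h.support i j t hne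
    simp only [EReal.coe_le_coe_iff]
    exact ⟨h1, (le_truncEnd_iff (hb i) (by linarith)).2 h2, h3, (le_truncEnd_iff (hd j) hT).2 h4⟩
  shift i j s t hst hs ht := by
    have ht : t + δ ≤ truncEnd T (d j) := EReal.coe_le_coe_iff.1 ht
    have hT : t + δ ≤ T := ht.trans (truncEnd_le (hdT j))
    rw [if_pos hT, if_pos (by linarith)]
    exact h.shift i j s t hst hs ((le_truncEnd_iff (hd j) hT).1 ht)

lemma ComposeToShift.trunc [Fintype κ] {a : ι → ℝ} {b : ι → EReal} {f : ι → κ → ℝ → 𝔽}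
    {g : κ → ι → ℝ → 𝔽}
    (h : ComposeToShift δ a b f g) (hδ : 0 < δ) {T : ℝ} (hb : ∀ i, b i ≠ ⊥)
    (hbT : ∀ i, b i ≠ ⊤ → (b i).toReal ≤ T) :
    ComposeToShift δ a (fun i => (truncEnd T (b i) : EReal))
      (fun i j t => if t + δ ≤ T then f i j t else 0)
      (fun j i t => if t + δ ≤ T then g j i t else 0) := by
  intro i i' t h1 h2 h3 h4
  have h4 : t + δ + δ ≤ truncEnd T (b i') := EReal.coe_le_coe_iff.1 h4
  have h2 : t ≤ truncEnd T (b i) := EReal.coe_le_coe_iff.1 h2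
  have hT : t + δ + δ ≤ T := h4.trans (truncEnd_le (hbT i'))
  simp only [if_pos hT, if_pos (show t + δ ≤ T by linarith)]
  exact h i i' t h1 ((le_truncEnd_iff (hb i) (by linarith)).1 h2) h3
    ((le_truncEnd_iff (hb i') hT).1 h4)

lemma Bar.valid.ne_bot {I : Bar} (h : Bar.valid I) : I.2 ≠ ⊥ := ne_bot_of_gt h

lemma barClose_of_truncEnd {T : ℝ} {I J : Bar} (h1 : |I.1 - J.1| ≤ δ)
    (h2 : |truncEnd T I.2 - truncEnd T J.2| ≤ δ) (hI : I.2.toReal + δ < T)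
    (hJ : J.2.toReal + δ < T) : BarClose δ I J := by
  refine ⟨h1, ?_⟩
  unfold truncEnd at h2
  split_ifs at h2 with h5 h6 h6
  · exact Or.inl ⟨h5, h6⟩
  · rw [abs_le] at h2
    linarith
  · rw [abs_le] at h2
    linarith
  · exact Or.inr ⟨h5, h6, h2⟩

/-- An injection from the long bars of one side into close bars of the other side. -/
lemma exists_injective_barClose [Finite ι] [Fintype κ] {b : ι → Bar} {c : κ → Bar}
    {f : ι → κ → ℝ → 𝔽}
    {g : κ → ι → ℝ → 𝔽} (hb : ∀ i, Bar.valid (b i)) (hc : ∀ j, Bar.valid (c j))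
    (hf : ShiftCoeff δ (fun i => (b i).1) (fun i => (b i).2) (fun j => (c j).1)
      (fun j => (c j).2) f)
    (hg : ShiftCoeff δ (fun j => (c j).1) (fun j => (c j).2) (fun i => (b i).1)
      (fun i => (b i).2) g)
    (hfg : ComposeToShift δ (fun i => (b i).1) (fun i => (b i).2) f g) (hδ : 0 < δ) :
    ∃ p : {i // BarLong δ (b i)} → κ, Function.Injective p ∧
      ∀ i : {i // BarLong δ (b i)}, BarClose δ (b i) (c (p i)) := by
  obtain ⟨T₁, hT₁⟩ := (Set.finite_range fun i =>
    max ((b i).1 + 2 * δ) ((b i).2.toReal + δ)).bddAbove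
  obtain ⟨T₂, hT₂⟩ := (Set.finite_range fun j => (c j).2.toReal + δ).bddAbove
  obtain ⟨T, hT⟩ := exists_gt (max T₁ T₂)
  have hT1 : T₁ < T := (le_max_left _ _).trans_lt hT
  have hT2 : T₂ < T := (le_max_right _ _).trans_lt hT
  have hba : ∀ i, (b i).1 + 2 * δ < T := fun i =>
    (le_max_left _ _).trans_lt ((hT₁ ⟨i, rfl⟩).trans_lt hT1)
  have hbb : ∀ i, (b i).2.toReal + δ < T := fun i =>
    (le_max_right _ _).trans_lt ((hT₁ ⟨i, rfl⟩).trans_lt hT1)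
  have hcd : ∀ j, (c j).2.toReal + δ < T := fun j => (hT₂ ⟨j, rfl⟩).trans_lt hT2
  have hb0 := fun i => (hb i).ne_bot
  have hc0 := fun j => (hc j).ne_bot
  have hbT : ∀ i, (b i).2 ≠ ⊤ → (b i).2.toReal ≤ T := fun i _ => by linarith [hbb i]
  have hcT : ∀ j, (c j).2 ≠ ⊤ → (c j).2.toReal ≤ T := fun j _ => by linarith [hcd j]
  obtain ⟨p, hp, hclose⟩ := exists_injective_close_real (hf.trunc hδ hb0 hc0 hcT)
    (hg.trunc hδ hc0 hb0 hbT) (hfg.trunc hδ hb0 hbT) hδ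
  have hlong : ∀ i, BarLong δ (b i) → 2 * δ < truncEnd T (b i).2 - (b i).1 := by
    intro i hi
    have h1 := hba i
    have h2 := hb0 i
    unfold BarLong at hi
    generalize (b i).2 = x at *
    induction x with
    | bot => exact absurd rfl h2
    | top => simp only [truncEnd, if_true]; linarith
    | coe y =>
      simp only [truncEnd, EReal.coe_ne_top, if_false, EReal.toReal_coe]
      exact_mod_cast hi
  refine ⟨fun i => p ⟨i, hlong i i.2⟩, fun i j hij => Subtype.ext (by simpa using hp hij),
    fun i => ?_⟩
  have h := hclose ⟨i, hlong i i.2⟩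
  exact barClose_of_truncEnd h.1 h.2 (hbb i) (hcd _)

end Matching

lemma BarClose.symm {δ : ℝ} {I J : Bar} (h : BarClose δ I J) : BarClose δ J I := by
  refine ⟨abs_sub_comm I.1 J.1 ▸ h.1, h.2.imp And.symm fun h => ⟨h.2.1, h.1, ?_⟩⟩
  rw [abs_sub_comm]
  exact h.2.2

/-- Two partial injections compatible with a relation `R`, defined on `P` and `Q` respectively,
can be combined into a partial bijection which covers both `P` and `Q`. -/
lemma exists_partial_matching {n k : ℕ} {R : Fin n → Fin k → Prop} {P : Fin n → Prop}
    {Q : Fin k → Prop} (p : {i // P i} → Fin k) (hp : Function.Injective p)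
    (hpR : ∀ i : {i // P i}, R i (p i)) (q : {j // Q j} → Fin n) (hq : Function.Injective q)
    (hqR : ∀ j : {j // Q j}, R (q j) j) :
    ∃ S : Finset (Fin n × Fin k), Set.InjOn Prod.fst (S : Set (Fin n × Fin k)) ∧
      Set.InjOn Prod.snd (S : Set (Fin n × Fin k)) ∧ (∀ x ∈ S, R x.1 x.2) ∧
      (∀ i, P i → ∃ x ∈ S, x.1 = i) ∧ ∀ j, Q j → ∃ x ∈ S, x.2 = j := by
  let f : Fin n ⊕ ℕ → Fin k ⊕ ℕ :=
    Sum.elim (fun i => if h : P i then Sum.inl (p ⟨i, h⟩) else Sum.inr i) fun m => Sum.inr (m + n)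
  let g : Fin k ⊕ ℕ → Fin n ⊕ ℕ :=
    Sum.elim (fun j => if h : Q j then Sum.inl (q ⟨j, h⟩) else Sum.inr j) fun m => Sum.inr (m + k)
  let R' : Fin n ⊕ ℕ → Fin k ⊕ ℕ → Prop := fun x y =>
    Sum.elim (fun i => Sum.elim (fun j => R i j) (fun _ => ¬ P i) y)
      (fun _ => Sum.elim (fun j => ¬ Q j) (fun _ => True) y) x
  have hf : Function.Injective f := by
    rintro (i | m) (i' | m') h
    · by_cases h1 : P i <;> by_cases h2 : P i' <;> simp [f, h1, h2] at h
      · simpa using hp h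
      · rw [Fin.ext h]
    · by_cases h1 : P i <;> simp [f, h1] at h
      omega
    · by_cases h1 : P i' <;> simp [f, h1] at h
      omega
    · simpa [f] using h
  have hg : Function.Injective g := by
    rintro (i | m) (i' | m') h
    · by_cases h1 : Q i <;> by_cases h2 : Q i' <;> simp [g, h1, h2] at h
      · simpa using hq h
      · rw [Fin.ext h]
    · by_cases h1 : Q i <;> simp [g, h1] at h
      omega
    · by_cases h1 : Q i' <;> simp [g, h1] at h
      omega
    · simpa [g] using h
  obtain ⟨h, hbij, hR⟩ := Function.Embedding.schroeder_bernstein_of_rel hf hg R'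
    (by
      rintro (i | m)
      · by_cases h1 : P i
        · simpa [f, R', h1] using hpR ⟨i, h1⟩
        · simp [f, R', h1]
      · simp [f, R'])
    (by
      rintro (i | m)
      · by_cases h1 : Q i
        · simpa [g, R', h1] using hqR ⟨i, h1⟩
        · simp [g, R', h1]
      · simp [g, R'])
  refine ⟨Finset.univ.filter fun x => h (Sum.inl x.1) = Sum.inl x.2, ?_, ?_, ?_, ?_, ?_⟩
  · rintro ⟨i, j⟩ hx ⟨i', j'⟩ hy (rfl : i = i')
    simp only [Finset.coe_filter, Finset.mem_univ, true_and, Set.mem_ofPred_eq] at hx hy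
    rw [hx] at hy
    simpa using hy
  · rintro ⟨i, j⟩ hx ⟨i', j'⟩ hy (rfl : j = j')
    simp only [Finset.coe_filter, Finset.mem_univ, true_and, Set.mem_ofPred_eq] at hx hy
    simpa using hbij.1 (hx.trans hy.symm)
  · rintro ⟨i, j⟩ hx
    simp only [Finset.mem_filter, Finset.mem_univ, true_and] at hx
    have := hR (Sum.inl i)
    rw [hx] at this
    exact this
  · intro i hi
    have := hR (Sum.inl i)
    rcases e : h (Sum.inl i) with j | m
    · exact ⟨(i, j), by simpa using e, rfl⟩
    · rw [e] at this
      exact absurd hi this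
  · intro j hj
    obtain ⟨x, hx⟩ := hbij.2 (Sum.inl j)
    have := hR x
    rw [hx] at this
    rcases x with i | m
    · exact ⟨(i, j), by simpa using hx, rfl⟩
    · exact absurd hj this

section Coordinates

variable {𝔽 : Type} [Field 𝔽] {B C : Multiset Bar} {δ : ℝ}

lemma univ_val_map_toList_get (B : Multiset Bar) :
    (Finset.univ : Finset (Fin B.toList.length)).val.map B.toList.get = B := by
  rw [Fin.univ_val_map, List.ofFn_get, Multiset.coe_toList]

lemma map_le_of_injOn {α : Type} {B : Multiset Bar} (S : Finset α)
    (e : α → Fin B.toList.length) (he : Set.InjOn e (S : Set α)) :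
    S.val.map (fun x => B.toList.get (e x)) ≤ B := by
  conv_rhs => rw [← univ_val_map_toList_get B]
  rw [← Function.comp_def, ← Multiset.map_map, ← Finset.image_val_of_injOn he]
  exact Multiset.map_le_map (Finset.val_le_iff.2 (Finset.subset_univ _))

lemma cfilter_le_map {α : Type} {B : Multiset Bar} (S : Finset α)
    (e : α → Fin B.toList.length) (he : Set.InjOn e (S : Set α)) (P : Bar → Prop)
    (h : ∀ i, P (B.toList.get i) → ∃ x ∈ S, e x = i) :
    cfilter P B ≤ S.val.map (fun x => B.toList.get (e x)) := by
  unfold cfilter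
  conv_lhs => rw [← univ_val_map_toList_get B]
  rw [← Function.comp_def, ← Multiset.map_map, ← Finset.image_val_of_injOn he,
    Multiset.filter_map, ← Finset.filter_val]
  refine Multiset.map_le_map (Finset.val_le_iff.2 fun i hi => ?_)
  obtain ⟨x, hx, rfl⟩ := h i (by simpa using hi)
  exact Finset.mem_image_of_mem e hx

/-- The generator at time `t` of the `i`-th bar (zero if the bar is not alive at `t`). -/
noncomputable def barGen (𝔽 : Type) [Field 𝔽] (B : Multiset Bar) (i : Fin B.toList.length)
    (t : ℝ) : (barcodeModule 𝔽 B).V t :=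
  fun i' => ⟨if i = i' ∧ Bar.has (B.toList.get i') t then 1 else 0, by
    split_ifs with h
    · rw [barSub, if_pos h.2]
      exact Submodule.mem_top
    · exact Submodule.zero_mem _⟩

/-- The `i`-th coordinate of an element of a direct sum of interval modules. -/
noncomputable def barCoord (B : Multiset Bar) (i : Fin B.toList.length) (t : ℝ) :
    (barcodeModule 𝔽 B).V t →ₗ[𝔽] 𝔽 :=
  (barSub 𝔽 (B.toList.get i) t).subtype.comp (LinearMap.proj i)

lemma barCoord_ext {t : ℝ} {x y : (barcodeModule 𝔽 B).V t}
    (h : ∀ i, barCoord B i t x = barCoord B i t y) : x = y :=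
  funext fun i => Subtype.ext (h i)

lemma barCoord_barGen (i i' : Fin B.toList.length) (t : ℝ) :
    barCoord B i' t (barGen 𝔽 B i t) =
      if i = i' ∧ Bar.has (B.toList.get i') t then 1 else 0 := rfl

lemma barCoord_pi (i : Fin B.toList.length) {s t : ℝ} (h : s ≤ t)
    (x : (barcodeModule 𝔽 B).V s) :
    barCoord B i t ((barcodeModule 𝔽 B).π s t h x) =
      if Bar.has (B.toList.get i) t then barCoord B i s x else 0 := rfl

lemma barCoord_eq_zero {i : Fin B.toList.length} {t : ℝ} (h : ¬ Bar.has (B.toList.get i) t)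
    (x : (barcodeModule 𝔽 B).V t) : barCoord B i t x = 0 :=
  barSub_coe_zero h _

lemma pi_barGen (i : Fin B.toList.length) {s t : ℝ} (h : s ≤ t) (hs : (B.toList.get i).1 < s) :
    (barcodeModule 𝔽 B).π s t h (barGen 𝔽 B i s) = barGen 𝔽 B i t := by
  refine barCoord_ext fun i' => ?_
  rw [barCoord_pi, barCoord_barGen, barCoord_barGen]
  by_cases ht : Bar.has (B.toList.get i') t
  · by_cases hi : i = i'
    · subst hi
      have : Bar.has (B.toList.get i) s := ⟨hs, le_trans (by exact_mod_cast h) ht.2⟩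
      rw [if_pos ht, if_pos ⟨rfl, this⟩, if_pos ⟨rfl, ht⟩]
    · simp [hi]
  · rw [if_neg ht, if_neg fun h => ht h.2]

lemma eq_sum_barGen {t : ℝ} (x : (barcodeModule 𝔽 B).V t) :
    x = ∑ i, barCoord B i t x • barGen 𝔽 B i t := by
  refine barCoord_ext fun i => ?_
  rw [map_sum]
  simp only [map_smul, barCoord_barGen, smul_eq_mul]
  by_cases h : Bar.has (B.toList.get i) t
  · simp only [h, and_true, mul_ite, mul_one, mul_zero, Finset.sum_ite_eq', Finset.mem_univ,
      if_true]
  · simp only [h, and_false, if_false, mul_zero, Finset.sum_const_zero, barCoord_eq_zero h]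

/-- The matrix coefficients of a family of maps of degree `δ`. -/
noncomputable def coeff
    (F : ∀ t : ℝ, (barcodeModule 𝔽 B).V t →ₗ[𝔽] (barcodeModule 𝔽 C).V (t + δ))
    (i : Fin B.toList.length) (j : Fin C.toList.length) (t : ℝ) : 𝔽 :=
  barCoord C j (t + δ) (F t (barGen 𝔽 B i t))

lemma shiftCoeff_coeff
    (F : ∀ t : ℝ, (barcodeModule 𝔽 B).V t →ₗ[𝔽] (barcodeModule 𝔽 C).V (t + δ))
    (hF : ∀ (s t : ℝ) (h : s ≤ t), (F t).comp ((barcodeModule 𝔽 B).π s t h) =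
      ((barcodeModule 𝔽 C).π (s + δ) (t + δ) (by linarith)).comp (F s)) :
    ShiftCoeff δ (fun i => (B.toList.get i).1) (fun i => (B.toList.get i).2)
      (fun j => (C.toList.get j).1) (fun j => (C.toList.get j).2) (coeff F) where
  support i j t hne := by
    have h1 : Bar.has (B.toList.get i) t := by
      by_contra h
      refine hne ?_
      have : barGen 𝔽 B i t = 0 := barCoord_ext fun i' => by
        rw [barCoord_barGen, map_zero, if_neg]
        rintro ⟨rfl, h'⟩
        exact h h'
      rw [coeff, this, map_zero, map_zero]
    have h2 : Bar.has (C.toList.get j) (t + δ) := by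
      by_contra h
      exact hne (barCoord_eq_zero h _)
    exact ⟨h1.1, h1.2, h2.1, h2.2⟩
  shift i j s t hst hs ht := by
    have e := LinearMap.congr_fun (hF s t hst) (barGen 𝔽 B i s)
    rw [LinearMap.comp_apply, LinearMap.comp_apply, pi_barGen i hst hs] at e
    rw [coeff, e, barCoord_pi]
    split_ifs with h
    · rfl
    · refine (barCoord_eq_zero (fun h' => h ⟨?_, ht⟩) _).symm
      exact h'.1.trans_le (by linarith)

lemma composeToShift_coeff (hδ : 0 < δ)
    (F : ∀ t : ℝ, (barcodeModule 𝔽 B).V t →ₗ[𝔽] (barcodeModule 𝔽 C).V (t + δ))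
    (G : ∀ t : ℝ, (barcodeModule 𝔽 C).V t →ₗ[𝔽] (barcodeModule 𝔽 B).V (t + δ))
    (hFG : ∀ (t : ℝ) (h : t ≤ t + δ + δ),
      (G (t + δ)).comp (F t) = (barcodeModule 𝔽 B).π t (t + δ + δ) h) :
    ComposeToShift δ (fun i => (B.toList.get i).1) (fun i => (B.toList.get i).2)
      (coeff F) (coeff G) := by
  intro i i' t h1 _ h3 h4
  have ht : t ≤ t + δ + δ := by linarith
  have e := LinearMap.congr_fun (hFG t ht) (barGen 𝔽 B i t)
  rw [pi_barGen i ht h1, LinearMap.comp_apply, eq_sum_barGen (F t (barGen 𝔽 B i t))] at e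
  have e' := congrArg (barCoord B i' (t + δ + δ)) e
  have h : Bar.has (B.toList.get i') (t + δ + δ) := ⟨h3, h4⟩
  simp only [map_sum, map_smul, smul_eq_mul, barCoord_barGen, h, and_true] at e'
  refine Eq.trans e' ?_
  congr

lemma exists_isMatching (hδ : 0 < δ) (hB : ∀ I ∈ B, Bar.valid I) (hC : ∀ I ∈ C, Bar.valid I)
    (h : PersistenceModule.Interleaved (barcodeModule 𝔽 B) (barcodeModule 𝔽 C) δ) :
    ∃ m, IsMatching δ B C m := by
  obtain ⟨F, G, hF, hG, hFG, hGF⟩ := h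
  have hb : ∀ i, Bar.valid (B.toList.get i) := fun i =>
    hB _ (Multiset.mem_toList.1 (List.get_mem _ _))
  have hc : ∀ j, Bar.valid (C.toList.get j) := fun j =>
    hC _ (Multiset.mem_toList.1 (List.get_mem _ _))
  obtain ⟨p, hp, hpR⟩ := exists_injective_barClose hb hc (shiftCoeff_coeff F hF)
    (shiftCoeff_coeff G hG) (composeToShift_coeff hδ F G hFG) hδ
  obtain ⟨q, hq, hqR⟩ := exists_injective_barClose hc hb (shiftCoeff_coeff G hG)
    (shiftCoeff_coeff F hF) (composeToShift_coeff hδ G F hGF) hδ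
  obtain ⟨S, hS1, hS2, hSR, hSP, hSQ⟩ := exists_partial_matching
    (R := fun i j => BarClose δ (B.toList.get i) (C.toList.get j)) p hp hpR q hq
    fun j => (hqR j).symm
  refine ⟨S.val.map fun x => (B.toList.get x.1, C.toList.get x.2), ?_, ?_, ?_, ?_, ?_⟩
  · rw [Multiset.map_map]
    exact map_le_of_injOn S Prod.fst hS1
  · rw [Multiset.map_map]
    exact map_le_of_injOn S Prod.snd hS2
  · rw [Multiset.map_map]
    exact cfilter_le_map S Prod.fst hS1 _ hSP
  · rw [Multiset.map_map]
    exact cfilter_le_map S Prod.snd hS2 _ hSQ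
  · intro x hx
    obtain ⟨y, hy, rfl⟩ := Multiset.mem_map.1 hx
    exact hSR y hy

end Coordinates

namespace PersistenceModule

variable {𝔽 : Type} [Field 𝔽] {M M' N N' : PersistenceModule 𝔽} {δ : ℝ}

lemma Hom.comm_apply (f : Hom M N) {s t : ℝ} (h : s ≤ t) (x : M.V s) :
    f.A t (M.π s t h x) = N.π s t h (f.A s x) :=
  LinearMap.congr_fun (f.comm s t h) x

/-- Interleavings transport along isomorphisms. -/
lemma Interleaved.of_iso (h : Interleaved M N δ) (hM : Iso M M') (hN : Iso N N') :
    Interleaved M' N' δ := by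
  obtain ⟨F, G, hF, hG, hFG, hGF⟩ := h
  obtain ⟨f, f', hff', hf'f⟩ := hM
  obtain ⟨g, g', hgg', hg'g⟩ := hN
  refine ⟨fun t => (g.A (t + δ)).comp ((F t).comp (f'.A t)),
    fun t => (f.A (t + δ)).comp ((G t).comp (g'.A t)), fun s t h => ?_, fun s t h => ?_,
    fun t h => ?_, fun t h => ?_⟩ <;> ext x
  · have := LinearMap.congr_fun (hF s t h) (f'.A s x)
    simp only [LinearMap.comp_apply] at this ⊢
    rw [f'.comm_apply, this, g.comm_apply]
  · have := LinearMap.congr_fun (hG s t h) (g'.A s x)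
    simp only [LinearMap.comp_apply] at this ⊢
    rw [g'.comm_apply, this, f.comm_apply]
  · have := LinearMap.congr_fun (hFG t h) (f'.A t x)
    simp only [LinearMap.comp_apply] at this ⊢
    rw [hgg', this, f.comm_apply, hf'f]
  · have := LinearMap.congr_fun (hGF t h) (g'.A t x)
    simp only [LinearMap.comp_apply] at this ⊢
    rw [hff', this, g.comm_apply, hg'g]

end PersistenceModule

/-- **Algebraic Stability Theorem.** For any two persistence modules `M` and `N` with
barcodes `B` and `C`, one has `d_int(M,N) ≥ d_bot(B,C)`. -/
theorem algebraic_stability {𝔽 : Type} [Field 𝔽]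
    (M N : PersistenceModule 𝔽) (hM : M.IsRegular) (hN : N.IsRegular)
    (B C : Multiset Bar) (hB : ∀ I ∈ B, Bar.valid I) (hC : ∀ I ∈ C, Bar.valid I)
    (hMB : PersistenceModule.Iso M (barcodeModule 𝔽 B))
    (hNC : PersistenceModule.Iso N (barcodeModule 𝔽 C)) :
    dBot B C ≤ PersistenceModule.dInt M N := by
  refine sInf_le_sInf ?_
  rintro _ ⟨δ, hδ, rfl, h⟩
  exact ⟨δ, hδ, rfl, exists_isMatching hδ hB hC (h.of_iso hMB hNC)⟩
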